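/- arXiv:1907.12948 — 2 statements merged into one kernel-verified Lean document; each statement's English description precedes it below -/
import Mathlib

section
/- Let α be an external number and A = (α_{ij}) an n×n matrix over 𝔼 such that R(α) ≤ R(α_{ij}) for all 1 ≤ i, j ≤ n. Let k ∈ {1,…,n} and let B = (β_{ij}) be obtained from A by multiplying row k by α, i.e. β_{ij} = α_{ij} for i ≠ k and β_{kj} = α·α_{kj} for all j. Then det(B) = α·det(A). -/
open scoped Pointwise Classical

noncomputable section

-- Note: `ℝ*` is Mathlib's notation for the hyperreals `Hyperreal`.

/-- A neutrix: an order-convex additive subgroup of the hyperreals. -/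
def IsNeutrix (A : Set ℝ*) : Prop :=
  (0 : ℝ*) ∈ A ∧ (∀ x ∈ A, ∀ y ∈ A, x + y ∈ A) ∧ (∀ x ∈ A, -x ∈ A) ∧
    ∀ x ∈ A, ∀ y ∈ A, ∀ z : ℝ*, x ≤ z → z ≤ y → z ∈ A

/-- The coset `a + A`. -/
def coset (a : ℝ*) (A : Set ℝ*) : Set ℝ* := {x | ∃ u ∈ A, x = a + u}

/-- `α` is an external number: a coset of a neutrix. -/
def IsExt (α : Set ℝ*) : Prop := ∃ a A, IsNeutrix A ∧ α = coset a A

/-- The neutrix part `N(α)` of an external number, as the set of differences. -/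
def Nx (α : Set ℝ*) : Set ℝ* := {d | ∃ x ∈ α, ∃ y ∈ α, d = x - y}

/-- An external number is zeroless if it does not contain `0`. -/
def Zeroless (α : Set ℝ*) : Prop := (0 : ℝ*) ∉ α

/-- Multiplication of external numbers: `αβ = ab + aB + bA + AB`
(independent of the chosen representatives). -/
def emul (α β : Set ℝ*) : Set ℝ* :=
  {z | ∃ a A b B, IsNeutrix A ∧ IsNeutrix B ∧ α = coset a A ∧ β = coset b B ∧
      ∃ u ∈ A, ∃ v ∈ B, ∃ u' ∈ A, ∃ v' ∈ B, z = a * b + a * v + b * u + u' * v'}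

/-- Multiplication of an external number by a hyperreal scalar: `t·α = ta + tA`. -/
def esmul (t : ℝ*) (α : Set ℝ*) : Set ℝ* := (fun x => t * x) '' α

/-- Inverse of a (zeroless) external number: `1/α = 1/a + A/a²`. -/
def einv (α : Set ℝ*) : Set ℝ* :=
  {z | ∃ a A, IsNeutrix A ∧ α = coset a A ∧ ∃ u ∈ A, z = a⁻¹ + u / a ^ 2}

/-- Division of external numbers: `α/β = α · (1/β)`. -/
def ediv (α β : Set ℝ*) : Set ℝ* := emul α (einv β)

/-- The neutrix `⊘` of infinitesimal hyperreals. -/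
def oslash : Set ℝ* := {x | Hyperreal.Infinitesimal x}

/-- Relative uncertainty `R(α)`: `A/a` if `α = a + A` is zeroless,
and all of `ℝ*` if `α` is a neutrix. -/
def RU (α : Set ℝ*) : Set ℝ* :=
  if (0 : ℝ*) ∈ α then Set.univ
  else {z | ∃ a A, IsNeutrix A ∧ α = coset a A ∧ ∃ u ∈ A, z = u / a}

/-- `α` and `β` are nearly opposite: both zeroless and `α/β ⊆ -1 + ⊘`. -/
def NearlyOpposite (α β : Set ℝ*) : Prop :=
  Zeroless α ∧ Zeroless β ∧ ediv α β ⊆ coset (-1) oslash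

/-- Order on external numbers: `α ≤ β` iff `∀ x ∈ α, ∃ y ∈ β, x ≤ y`. -/
def ele (α β : Set ℝ*) : Prop := ∀ x ∈ α, ∃ y ∈ β, x ≤ y

/-- `α` is non-negative: some element of `α` is `≥ 0`. -/
def eNonneg (α : Set ℝ*) : Prop := ∃ x ∈ α, (0 : ℝ*) ≤ x

/-- Absolute value of an external number: `|α| = |a| + A`. -/
def eabs (α : Set ℝ*) : Set ℝ* :=
  {z | ∃ a A, IsNeutrix A ∧ α = coset a A ∧ ∃ u ∈ A, z = |a| + u}

/-- Product of a finite family of external numbers. -/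
def eprod : ∀ {n : ℕ}, (Fin n → Set ℝ*) → Set ℝ*
  | 0, _ => {1}
  | _ + 1, f => emul (f 0) (eprod fun i => f i.succ)

/-- Power of an external number. -/
def epow (α : Set ℝ*) : ℕ → Set ℝ*
  | 0 => {1}
  | k + 1 => emul α (epow α k)

/-- Matrix product over external numbers: `(AB)_{ij} = Σ_k α_{ik}β_{kj}`. -/
def matMul {m n p : ℕ} (M : Matrix (Fin m) (Fin n) (Set ℝ*))
    (N : Matrix (Fin n) (Fin p) (Set ℝ*)) : Matrix (Fin m) (Fin p) (Set ℝ*) :=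
  fun i j => ∑ k, emul (M i k) (N k j)

/-- Entrywise (Minkowski) sum of matrices over external numbers. -/
def matAdd {m n : ℕ} (M N : Matrix (Fin m) (Fin n) (Set ℝ*)) :
    Matrix (Fin m) (Fin n) (Set ℝ*) := fun i j => M i j + N i j

/-- Entrywise scalar multiple of a matrix by an external number. -/
def matSmul {m n : ℕ} (α : Set ℝ*) (M : Matrix (Fin m) (Fin n) (Set ℝ*)) :
    Matrix (Fin m) (Fin n) (Set ℝ*) := fun i j => emul α (M i j)

/-- Entrywise inclusion of matrices over external numbers. -/
def matIncl {m n : ℕ} (M N : Matrix (Fin m) (Fin n) (Set ℝ*)) : Prop :=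
  ∀ i j, M i j ⊆ N i j

/-- Determinant of a square matrix over the external numbers. -/
def detE {n : ℕ} (M : Matrix (Fin n) (Fin n) (Set ℝ*)) : Set ℝ* :=
  ∑ σ : Equiv.Perm (Fin n),
    esmul ((Equiv.Perm.sign σ : ℤ) : ℝ*) (eprod fun i => M i (σ i))

/-- The `(i,j)` minor of a square matrix over the external numbers. -/
def minorE {n : ℕ} (M : Matrix (Fin (n + 1)) (Fin (n + 1)) (Set ℝ*))
    (i j : Fin (n + 1)) : Set ℝ* :=
  detE (M.submatrix i.succAbove j.succAbove)

/-- The near-identity matrix `I_n(N)`: diagonal entries `1 + N`, off-diagonal entries `N`. -/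
def Iun (n : ℕ) (N : Set ℝ*) : Matrix (Fin n) (Fin n) (Set ℝ*) :=
  fun i j => if i = j then coset 1 N else N

/-- A finite family of vectors of external numbers is linearly dependent:
some nontrivial real (hyperreal) linear combination is a neutrix vector. -/
def LinDepE {ι : Type*} [Fintype ι] {n : ℕ} (ξ : ι → Fin n → Set ℝ*) : Prop :=
  ∃ t : ι → ℝ*, (∃ i, t i ≠ 0) ∧ ∃ A : Fin n → Set ℝ*,
    (∀ j, IsNeutrix (A j)) ∧ ∀ j, (∑ i, esmul (t i) (ξ i j)) = A j

/-- The matrix has a zeroless minor of order `k`. -/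
def HasZerolessMinor {m n : ℕ} (M : Matrix (Fin m) (Fin n) (Set ℝ*)) (k : ℕ) : Prop :=
  ∃ (f : Fin k → Fin m) (g : Fin k → Fin n), Function.Injective f ∧ Function.Injective g ∧
    Zeroless (detE fun i j => M (f i) (g j))

/-- The minor rank of `M` is `r`. -/
def minorRankIs {m n : ℕ} (M : Matrix (Fin m) (Fin n) (Set ℝ*)) (r : ℕ) : Prop :=
  HasZerolessMinor M r ∧ ∀ k, HasZerolessMinor M k → k ≤ r

/-- The row rank of `M` is `r`: the maximal cardinality of a linearly
independent set of row vectors of `M` is `r`. -/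
def rowRankIs {m n : ℕ} (M : Matrix (Fin m) (Fin n) (Set ℝ*)) (r : ℕ) : Prop :=
  (∃ s : Finset (Fin m), s.card = r ∧ ¬ LinDepE fun (i : {x // x ∈ s}) j => M i.1 j) ∧
  ∀ s : Finset (Fin m), (¬ LinDepE fun (i : {x // x ∈ s}) j => M i.1 j) → s.card ≤ r

/-- `M` is a reduced matrix: `max_{i,j} |α_{ij}| = 1 + A₀` for some neutrix `A₀ ⊆ ⊘`. -/
def IsReducedMat {m n : ℕ} (M : Matrix (Fin m) (Fin n) (Set ℝ*)) : Prop :=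
  ∃ A₀, IsNeutrix A₀ ∧ A₀ ⊆ oslash ∧ (∃ i j, eabs (M i j) = coset 1 A₀) ∧
    ∀ i j, ele (eabs (M i j)) (coset 1 A₀)

namespace IsNeutrix

variable {A B : Set ℝ*}

lemma mem_of_abs_le (hA : IsNeutrix A) {x y : ℝ*} (hx : x ∈ A) (h : |y| ≤ |x|) : y ∈ A := by
  obtain ⟨-, -, hneg, hconv⟩ := hA
  have habs : |x| ∈ A := by
    rcases abs_choice x with h | h <;> rw [h]
    exacts [hx, hneg x hx]
  exact hconv _ (hneg _ habs) _ habs y (abs_le.1 h).1 (abs_le.1 h).2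

lemma of_abs_le (h0 : (0 : ℝ*) ∈ A) (hadd : ∀ x ∈ A, ∀ y ∈ A, x + y ∈ A)
    (habs : ∀ x ∈ A, ∀ y, |y| ≤ |x| → y ∈ A) : IsNeutrix A := by
  refine ⟨h0, hadd, fun x hx => habs x hx _ (abs_neg x).le, fun x hx y hy z hxz hzy => ?_⟩
  rcases le_total 0 z with hz | hz
  · exact habs y hy z (abs_le_abs_of_nonneg hz hzy)
  · exact habs x hx z (abs_le_abs_of_nonpos hz hxz)

lemma abs_mem (hA : IsNeutrix A) {x : ℝ*} (hx : x ∈ A) : |x| ∈ A :=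
  hA.mem_of_abs_le hx (abs_abs x).le

lemma exists_bound (hA : IsNeutrix A) {x y : ℝ*} (hx : x ∈ A) (hy : y ∈ A) :
    ∃ m ∈ A, 0 ≤ m ∧ |x| ≤ m ∧ |y| ≤ m :=
  ⟨|x| + |y|, hA.2.1 _ (hA.abs_mem hx) _ (hA.abs_mem hy), by positivity,
    by linarith [abs_nonneg y], by linarith [abs_nonneg x]⟩

lemma abs_lt_of_notMem (hA : IsNeutrix A) {a u : ℝ*} (ha : a ∉ A) (hu : u ∈ A) : |u| < |a| := by
  by_contra! h
  exact ha (hA.mem_of_abs_le hu h)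

lemma zero : IsNeutrix {(0 : ℝ*)} :=
  of_abs_le rfl (by simp) (by simp)

lemma add (hA : IsNeutrix A) (hB : IsNeutrix B) : IsNeutrix (A + B) := by
  refine of_abs_le ⟨0, hA.1, 0, hB.1, add_zero 0⟩ ?_ ?_
  · rintro _ ⟨a, ha, b, hb, rfl⟩ _ ⟨c, hc, d, hd, rfl⟩
    exact ⟨a + c, hA.2.1 _ ha _ hc, b + d, hB.2.1 _ hb _ hd, by simp only; ring⟩
  · rintro _ ⟨a, ha, b, hb, rfl⟩ z hz
    have hz' : |z| ≤ |a| + |b| := hz.trans (abs_add_le a b)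
    rcases le_total |a| |b| with h | h
    · refine ⟨0, hA.1, z, hB.mem_of_abs_le (hB.2.1 _ (hB.abs_mem hb) _ (hB.abs_mem hb)) ?_,
        zero_add z⟩
      exact (hz'.trans (by linarith)).trans (le_abs_self _)
    · refine ⟨z, hA.mem_of_abs_le (hA.2.1 _ (hA.abs_mem ha) _ (hA.abs_mem ha)) ?_, 0, hB.1,
        add_zero z⟩
      exact (hz'.trans (by linarith)).trans (le_abs_self _)

lemma smul (t : ℝ*) (hA : IsNeutrix A) : IsNeutrix (t • A) := by
  refine of_abs_le ⟨0, hA.1, mul_zero t⟩ ?_ ?_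
  · rintro _ ⟨a, ha, rfl⟩ _ ⟨c, hc, rfl⟩
    exact ⟨a + c, hA.2.1 _ ha _ hc, mul_add t a c⟩
  · rintro _ ⟨a, ha, rfl⟩ z hz
    simp only [smul_eq_mul, abs_mul] at hz
    rcases eq_or_ne t 0 with rfl | ht
    · exact ⟨0, hA.1, by simpa [eq_comm] using hz⟩
    · refine ⟨z / t, hA.mem_of_abs_le ha ?_, mul_div_cancel₀ z ht⟩
      rw [abs_div, div_le_iff₀ (abs_pos.2 ht)]
      linarith

lemma mem_mul_of_abs_le (hB : IsNeutrix B) {m n z : ℝ*} (hm : m ∈ A)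
    (hn : n ∈ B) (hz : |z| ≤ |m| * |n|) : z ∈ A * B := by
  rcases eq_or_ne m 0 with rfl | h
  · have : z = 0 := by simpa using hz
    exact ⟨0, hm, n, hn, by simp [this]⟩
  · refine ⟨m, hm, z / m, hB.mem_of_abs_le hn ?_, mul_div_cancel₀ z h⟩
    rw [abs_div, div_le_iff₀ (abs_pos.2 h)]
    linarith

lemma mul (hA : IsNeutrix A) (hB : IsNeutrix B) : IsNeutrix (A * B) := by
  refine of_abs_le ⟨0, hA.1, 0, hB.1, mul_zero 0⟩ ?_ ?_
  · rintro _ ⟨a, ha, b, hb, rfl⟩ _ ⟨c, hc, d, hd, rfl⟩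
    obtain ⟨m, hm, hm0, ham, hcm⟩ := hA.exists_bound ha hc
    obtain ⟨n, hn, hn0, hbn, hdn⟩ := hB.exists_bound hb hd
    refine hB.mem_mul_of_abs_le hm (hB.2.1 _ hn _ hn) ?_
    rw [abs_of_nonneg hm0, abs_of_nonneg (by positivity : (0 : ℝ*) ≤ n + n), mul_add]
    refine (abs_add_le _ _).trans ?_
    simp only [abs_mul]
    gcongr
  · rintro _ ⟨a, ha, b, hb, rfl⟩ z hz
    exact hB.mem_mul_of_abs_le ha hb (hz.trans (abs_mul a b).le)

lemma mul_add_eq {C : Set ℝ*} (hA : IsNeutrix A) (hB : IsNeutrix B) (hC : IsNeutrix C) :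
    A * (B + C) = A * B + A * C := by
  refine (Set.mul_add_subset A B C).antisymm ?_
  rintro _ ⟨x, hx, y, hy, rfl⟩
  have hBC : B ⊆ B + C := fun b hb => ⟨b, hb, 0, hC.1, add_zero b⟩
  have hCB : C ⊆ B + C := fun c hc => ⟨0, hB.1, c, hc, zero_add c⟩
  exact (hA.mul (hB.add hC)).2.1 x (Set.mul_subset_mul_left hBC hx) y
    (Set.mul_subset_mul_left hCB hy)

/-- For `a ∉ A`, the neutrix `a•B` absorbs `A * B`. -/
lemma exists_mul_add_mul_eq (hA : IsNeutrix A) (hB : IsNeutrix B) {a u v w : ℝ*} (ha : a ∉ A)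
    (hu : u ∈ A) (hv : v ∈ B) (hw : w ∈ B) : ∃ x ∈ B, a * v + u * w = a * x := by
  have ha0 : a ≠ 0 := fun h => ha (h ▸ hA.1)
  refine ⟨v + u * w / a, hB.2.1 _ hv _ (hB.mem_of_abs_le hw ?_), by field_simp⟩
  rw [abs_div, abs_mul, div_le_iff₀ (abs_pos.2 ha0), mul_comm]
  exact mul_le_mul_of_nonneg_left (hA.abs_lt_of_notMem ha hu).le (abs_nonneg w)

end IsNeutrix

lemma coset_eq_of_mem {A : Set ℝ*} (hA : IsNeutrix A) {a : ℝ*} (ha : a ∈ A) : coset a A = A := by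
  ext x
  constructor
  · rintro ⟨u, hu, rfl⟩
    exact hA.2.1 _ ha _ hu
  · intro hx
    exact ⟨x + -a, hA.2.1 _ hx _ (hA.2.2.1 _ ha), by ring⟩

lemma zero_mem_coset {A : Set ℝ*} (hA : IsNeutrix A) {a : ℝ*} :
    (0 : ℝ*) ∈ coset a A ↔ a ∈ A := by
  constructor
  · rintro ⟨u, hu, h⟩
    rw [eq_neg_of_add_eq_zero_left h.symm]
    exact hA.2.2.1 _ hu
  · intro h
    rw [coset_eq_of_mem hA h]
    exact hA.1

lemma mem_coset_mul_coset_of_notMem {A B : Set ℝ*} (hA : IsNeutrix A) (hB : IsNeutrix B)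
    {a b u v u' v' : ℝ*} (ha : a ∉ A) (hu : u ∈ A) (hv : v ∈ B) (hu' : u' ∈ A) (hv' : v' ∈ B) :
    a * b + a * v + b * u + u' * v' ∈ coset a A * coset b B := by
  have ha0 : a ≠ 0 := fun h => ha (h ▸ hA.1)
  obtain ⟨x, hx, hxe⟩ := hA.exists_mul_add_mul_eq hB ha hu' hv hv'
  by_cases h : b * u / a ∈ B
  · refine ⟨a, ⟨0, hA.1, by simp⟩, b + (x + b * u / a), ⟨_, hB.2.1 _ hx _ h, rfl⟩, ?_⟩
    simp only
    field_simp
    linear_combination -hxe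
  · have hlt : |a| * |x| ≤ |b| * |u| := by
      have := hB.abs_lt_of_notMem h hx
      rw [abs_div, abs_mul, lt_div_iff₀ (abs_pos.2 ha0)] at this
      linarith
    have hb0 : b ≠ 0 := by
      rintro rfl
      exact h (by simpa using hB.1)
    refine ⟨a + (a * x / b + u), ⟨_, hA.2.1 _ (hA.mem_of_abs_le hu ?_) _ hu, rfl⟩, b,
      ⟨0, hB.1, by simp⟩, ?_⟩
    · rw [abs_div, abs_mul, div_le_iff₀ (abs_pos.2 hb0)]
      linarith
    · simp only
      field_simp
      linear_combination -hxe

lemma mem_coset_mul_coset {A B : Set ℝ*} (hA : IsNeutrix A) (hB : IsNeutrix B)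
    {a b u v u' v' : ℝ*} (hu : u ∈ A) (hv : v ∈ B) (hu' : u' ∈ A) (hv' : v' ∈ B) :
    a * b + a * v + b * u + u' * v' ∈ coset a A * coset b B := by
  by_cases ha : a ∈ A
  · by_cases hb : b ∈ B
    · rw [coset_eq_of_mem hA ha, coset_eq_of_mem hB hb]
      have hadd := (hA.mul hB).2.1
      exact hadd _ (hadd _ (hadd _ (Set.mul_mem_mul ha hb) _ (Set.mul_mem_mul ha hv)) _
        (mul_comm u b ▸ Set.mul_mem_mul hu hb)) _ (Set.mul_mem_mul hu' hv')
    · rw [mul_comm (coset a A)]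
      convert mem_coset_mul_coset_of_notMem hB hA (b := a) hb hv hu hv' hu' using 1
      ring
  · exact mem_coset_mul_coset_of_notMem hA hB ha hu hv hu' hv'

/-- On external numbers, `emul` is the Minkowski product. -/
lemma emul_eq_mul {α β : Set ℝ*} (hα : IsExt α) (hβ : IsExt β) : emul α β = α * β := by
  apply Set.Subset.antisymm
  · rintro _ ⟨a, A, b, B, hA, hB, rfl, rfl, u, hu, v, hv, u', hu', v', hv', rfl⟩
    exact mem_coset_mul_coset hA hB hu hv hu' hv'
  · obtain ⟨a, A, hA, rfl⟩ := hα
    obtain ⟨b, B, hB, rfl⟩ := hβ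
    rintro _ ⟨_, ⟨u, hu, rfl⟩, _, ⟨v, hv, rfl⟩, rfl⟩
    exact ⟨a, A, b, B, hA, hB, rfl, rfl, u, hu, v, hv, u, hu, v, hv, by simp only; ring⟩

lemma coset_zero_right (t : ℝ*) : coset t {0} = {t} := by
  ext x
  simp [coset]

namespace IsExt

variable {α β : Set ℝ*}

lemma singleton (t : ℝ*) : IsExt {t} :=
  ⟨t, {0}, IsNeutrix.zero, (coset_zero_right t).symm⟩

lemma add (hα : IsExt α) (hβ : IsExt β) : IsExt (α + β) := by
  obtain ⟨a, A, hA, rfl⟩ := hα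
  obtain ⟨b, B, hB, rfl⟩ := hβ
  refine ⟨a + b, A + B, hA.add hB, Set.Subset.antisymm ?_ ?_⟩
  · rintro _ ⟨_, ⟨u, hu, rfl⟩, _, ⟨v, hv, rfl⟩, rfl⟩
    exact ⟨u + v, Set.add_mem_add hu hv, by simp only; ring⟩
  · rintro _ ⟨_, ⟨u, hu, v, hv, rfl⟩, rfl⟩
    exact ⟨a + u, ⟨u, hu, rfl⟩, b + v, ⟨v, hv, rfl⟩, by simp only; ring⟩

lemma mul (hα : IsExt α) (hβ : IsExt β) : IsExt (α * β) := by
  obtain ⟨a, A, hA, rfl⟩ := hα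
  obtain ⟨b, B, hB, rfl⟩ := hβ
  refine ⟨a * b, a • B + b • A + A * B, ((hB.smul a).add (hA.smul b)).add (hA.mul hB),
    Set.Subset.antisymm ?_ ?_⟩
  · rintro _ ⟨_, ⟨u, hu, rfl⟩, _, ⟨v, hv, rfl⟩, rfl⟩
    exact ⟨a * v + b * u + u * v, Set.add_mem_add (Set.add_mem_add ⟨v, hv, rfl⟩ ⟨u, hu, rfl⟩)
      (Set.mul_mem_mul hu hv), by simp only; ring⟩
  · rintro _ ⟨_, ⟨_, ⟨_, ⟨v, hv, rfl⟩, _, ⟨u, hu, rfl⟩, rfl⟩, _, ⟨u', hu', v', hv', rfl⟩, rfl⟩, rfl⟩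
    convert mem_coset_mul_coset hA hB (a := a) (b := b) hu hv hu' hv' using 1
    simp only [smul_eq_mul]
    ring

lemma smul (t : ℝ*) (hα : IsExt α) : IsExt (t • α) := by
  rw [← Set.singleton_smul, smul_eq_mul]
  exact (singleton t).mul hα

lemma sum {ι : Type*} (s : Finset ι) {f : ι → Set ℝ*} (hf : ∀ i, IsExt (f i)) :
    IsExt (∑ i ∈ s, f i) :=
  Finset.sum_induction f IsExt (fun _ _ => add) (singleton 0) fun i _ => hf i

lemma prod {ι : Type*} (s : Finset ι) {f : ι → Set ℝ*} (hf : ∀ i, IsExt (f i)) :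
    IsExt (∏ i ∈ s, f i) :=
  Finset.prod_induction f IsExt (fun _ _ => mul) (singleton 1) fun i _ => hf i

lemma isNeutrix (hα : IsExt α) (h0 : (0 : ℝ*) ∈ α) : IsNeutrix α := by
  obtain ⟨a, A, hA, rfl⟩ := hα
  rwa [coset_eq_of_mem hA ((zero_mem_coset hA).1 h0)]

lemma nonempty (hα : IsExt α) : α.Nonempty := by
  obtain ⟨a, A, hA, rfl⟩ := hα
  exact ⟨a, 0, hA.1, by simp⟩

end IsExt

lemma eprod_eq_prod : ∀ {n : ℕ} {f : Fin n → Set ℝ*}, (∀ i, IsExt (f i)) → eprod f = ∏ i, f i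
  | 0, _, _ => rfl
  | n + 1, f, hf => by
    have ih : eprod (fun i : Fin n => f i.succ) = ∏ i : Fin n, f i.succ :=
      eprod_eq_prod fun i => hf i.succ
    rw [eprod, ih, Fin.prod_univ_succ, emul_eq_mul (hf 0) (IsExt.prod Finset.univ fun i : Fin n => hf i.succ)]

lemma detE_eq_sum {n : ℕ} {M : Matrix (Fin n) (Fin n) (Set ℝ*)} (hM : ∀ i j, IsExt (M i j)) :
    detE M = ∑ σ : Equiv.Perm (Fin n),
      ((Equiv.Perm.sign σ : ℤ) : ℝ*) • ∏ i, M i (σ i) :=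
  Finset.sum_congr rfl fun σ _ => by rw [eprod_eq_prod fun i => hM i (σ i)]; rfl

/-- If `α` is zeroless and not less sharp than `β`, it acts on `β` as any of its centres. -/
lemma mul_eq_smul_of_RU_subset {A β : Set ℝ*} {a : ℝ*} (hA : IsNeutrix A) (ha : a ∉ A)
    (hβ : IsExt β) (hR : RU (coset a A) ⊆ RU β) : coset a A * β = a • β := by
  have ha0 : a ≠ 0 := fun h => ha (h ▸ hA.1)
  apply Set.Subset.antisymm
  · rintro _ ⟨_, ⟨u, hu, rfl⟩, y, hy, rfl⟩
    suffices h : y + u / a * y ∈ β from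
      ⟨_, h, by simp only [smul_eq_mul]; field_simp⟩
    by_cases h0 : (0 : ℝ*) ∈ β
    · have hN := hβ.isNeutrix h0
      refine hN.2.1 _ hy _ (hN.mem_of_abs_le hy ?_)
      rw [abs_mul, abs_div]
      refine mul_le_of_le_one_left (abs_nonneg y) ?_
      exact div_le_one_of_le₀ (hA.abs_lt_of_notMem ha hu).le (abs_nonneg a)
    · have hmem : u / a ∈ RU (coset a A) := by
        rw [RU, if_neg (mt (zero_mem_coset hA).1 ha)]
        exact ⟨a, A, hA, rfl, u, hu, rfl⟩
      have hmem' := hR hmem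
      rw [RU, if_neg h0] at hmem'
      obtain ⟨b, B, hB, rfl, w, hw, hwe⟩ := hmem'
      have hb : b ∉ B := mt (zero_mem_coset hB).2 h0
      have hb0 : b ≠ 0 := fun h => hb (h ▸ hB.1)
      obtain ⟨v, hv, rfl⟩ := hy
      refine ⟨v + (w + w * v / b), hB.2.1 _ hv _ (hB.2.1 _ hw _ (hB.mem_of_abs_le hw ?_)), ?_⟩
      · rw [abs_div, abs_mul, div_le_iff₀ (abs_pos.2 hb0)]
        exact mul_le_mul_of_nonneg_left (hB.abs_lt_of_notMem hb hv).le (abs_nonneg w)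
      · rw [hwe]
        field_simp
        ring
  · rintro _ ⟨y, hy, rfl⟩
    exact ⟨a, ⟨0, hA.1, by simp⟩, y, hy, rfl⟩

lemma zero_mem_of_RU_eq_univ {β : Set ℝ*} (hR : RU β = Set.univ) : (0 : ℝ*) ∈ β := by
  by_contra h0
  have h1 : (1 : ℝ*) ∈ RU β := hR ▸ Set.mem_univ _
  rw [RU, if_neg h0] at h1
  obtain ⟨b, B, hB, rfl, u, hu, h⟩ := h1
  have hb0 : b ≠ 0 := by
    rintro rfl
    exact h0 ((zero_mem_coset hB).2 hB.1)
  rw [eq_div_iff hb0, one_mul] at h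
  exact h0 ((zero_mem_coset hB).2 (h ▸ hu))

lemma mul_sum_of_mul_eq_smul {ι : Type*} (s : Finset ι) {α : Set ℝ*} {a : ℝ*} (ha : a ∈ α)
    {f : ι → Set ℝ*} (hf : ∀ i, α * f i = a • f i) :
    α * ∑ i ∈ s, f i = ∑ i ∈ s, α * f i := by
  suffices h : α * ∑ i ∈ s, f i = a • ∑ i ∈ s, f i by
    rw [h, Finset.smul_sum]
    exact Finset.sum_congr rfl fun i _ => (hf i).symm
  refine Finset.sum_induction f (fun β => α * β = a • β) (fun β γ hβ hγ => ?_) ?_ fun i _ => hf i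
  · apply Set.Subset.antisymm
    · refine (Set.mul_add_subset α β γ).trans ?_
      rw [hβ, hγ, smul_add]
    · rintro _ ⟨y, hy, rfl⟩
      exact ⟨a, ha, y, hy, rfl⟩
  · rw [smul_zero]
    exact Set.Nonempty.mul_zero ⟨a, ha⟩

lemma IsNeutrix.sum {ι : Type*} (s : Finset ι) {f : ι → Set ℝ*} (hf : ∀ i, IsNeutrix (f i)) :
    IsNeutrix (∑ i ∈ s, f i) :=
  Finset.sum_induction f IsNeutrix (fun _ _ => IsNeutrix.add) IsNeutrix.zero fun i _ => hf i

lemma IsNeutrix.mul_sum {ι : Type*} (s : Finset ι) {A : Set ℝ*} (hA : IsNeutrix A)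
    {f : ι → Set ℝ*} (hf : ∀ i, IsNeutrix (f i)) :
    A * ∑ i ∈ s, f i = ∑ i ∈ s, A * f i := by
  induction s using Finset.induction_on with
  | empty => simpa using Set.Nonempty.mul_zero ⟨0, hA.1⟩
  | insert i s hi ih =>
    rw [Finset.sum_insert hi, Finset.sum_insert hi, hA.mul_add_eq (hf i) (IsNeutrix.sum s hf), ih]

theorem stmt9 {n : ℕ} (α : Set ℝ*) (A B : Matrix (Fin n) (Fin n) (Set ℝ*)) (k : Fin n)
    (hα : IsExt α) (hA : ∀ i j, IsExt (A i j))
    (hR : ∀ i j, RU α ⊆ RU (A i j))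
    (hBoff : ∀ i j, i ≠ k → B i j = A i j) (hBk : ∀ j, B k j = emul α (A k j)) :
    detE B = emul α (detE A) := by
  have hBk' (j : Fin n) : B k j = α * A k j := by rw [hBk, emul_eq_mul hα (hA k j)]
  have hB (i j : Fin n) : IsExt (B i j) := by
    rcases eq_or_ne i k with rfl | h
    · rw [hBk']
      exact hα.mul (hA i j)
    · rw [hBoff i j h]
      exact hA i j
  have hprod (σ : Equiv.Perm (Fin n)) : ∏ i, B i (σ i) = α * ∏ i, A i (σ i) := by
    rw [← Finset.mul_prod_erase _ _ (Finset.mem_univ k),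
      ← Finset.mul_prod_erase _ (fun i => A i (σ i)) (Finset.mem_univ k), hBk', mul_assoc]
    congr 2
    exact Finset.prod_congr rfl fun i hi => hBoff i _ (Finset.ne_of_mem_erase hi)
  have hterm (σ : Equiv.Perm (Fin n)) :
      IsExt (((Equiv.Perm.sign σ : ℤ) : ℝ*) • ∏ i, A i (σ i)) :=
    (IsExt.prod _ fun i => hA i (σ i)).smul _
  rw [detE_eq_sum hA, detE_eq_sum hB, emul_eq_mul hα (IsExt.sum _ hterm)]
  simp only [hprod, ← mul_smul_comm]
  symm
  by_cases h0 : (0 : ℝ*) ∈ α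
  · refine (hα.isNeutrix h0).mul_sum _ fun σ => (hterm σ).isNeutrix ?_
    have hA0 (i j : Fin n) : (0 : ℝ*) ∈ A i j :=
      zero_mem_of_RU_eq_univ (Set.univ_subset_iff.1 (by simpa [RU, h0] using hR i j))
    rw [← Finset.mul_prod_erase _ _ (Finset.mem_univ k)]
    obtain ⟨y, hy⟩ := (IsExt.prod (Finset.univ.erase k) fun i => hA i (σ i)).nonempty
    have h := Set.mul_mem_mul (hA0 k (σ k)) hy
    rw [zero_mul] at h
    exact Set.zero_mem_smul_set h
  · obtain ⟨a, N, hN, rfl⟩ := hα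
    have ha : a ∈ coset a N := ⟨0, hN.1, by simp⟩
    refine mul_sum_of_mul_eq_smul _ ha fun σ => ?_
    rw [mul_smul_comm, smul_comm a, ← Finset.mul_prod_erase _ _ (Finset.mem_univ k), ← mul_assoc,
      mul_eq_smul_of_RU_subset hN (mt (zero_mem_coset hN).2 h0) (hA k (σ k)) (hR k (σ k)),
      smul_mul_assoc]
end
end

section
/- Let ξ₁,…,ξ_m be vectors in 𝔼ⁿ. (1) The set {ξ₁,…,ξ_m} is linearly dependent if and only if there exist representatives x₁,…,x_m (xᵢ ∈ (ℝ*)ⁿ a representative of ξᵢ) such that x₁,…,x_m are linearly dependent over the field ℝ*. (2) The set {ξ₁,…,ξ_m} is linearly independent if and only if every choice of representatives x₁,…,x_m of ξ₁,…,ξ_m is linearly independent over ℝ*. -/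
open scoped Pointwise Classical

noncomputable section

theorem IsNeutrix.zero_s15 : IsNeutrix {(0 : ℝ*)} := by
  refine ⟨rfl, ?_, ?_, ?_⟩
  · rintro x rfl y rfl
    simp
  · rintro x rfl
    simp
  · rintro x rfl y rfl z h₁ h₂
    exact le_antisymm h₂ h₁

theorem IsNeutrix.add_s15 {A B : Set ℝ*} (hA : IsNeutrix A) (hB : IsNeutrix B) :
    IsNeutrix (A + B) := by
  obtain ⟨hA0, hAadd, hAneg, hAconv⟩ := hA
  obtain ⟨hB0, hBadd, hBneg, hBconv⟩ := hB
  refine ⟨⟨0, hA0, 0, hB0, add_zero 0⟩, ?_, ?_, ?_⟩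
  · rintro _ ⟨a, ha, b, hb, rfl⟩ _ ⟨a', ha', b', hb', rfl⟩
    exact ⟨a + a', hAadd a ha a' ha', b + b', hBadd b hb b' hb', add_add_add_comm a a' b b'⟩
  · rintro _ ⟨a, ha, b, hb, rfl⟩
    exact ⟨-a, hAneg a ha, -b, hBneg b hb, (neg_add a b).symm⟩
  · rintro _ ⟨a, ha, b, hb, rfl⟩ _ ⟨a', ha', b', hb', rfl⟩ z h₁ h₂
    dsimp only at h₁ h₂
    have hminA : min a a' ∈ A := by rcases min_choice a a' with h | h <;> rwa [h]
    have hmaxA : max a a' ∈ A := by rcases max_choice a a' with h | h <;> rwa [h]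
    have hminB : min b b' ∈ B := by rcases min_choice b b' with h | h <;> rwa [h]
    have hmaxB : max b b' ∈ B := by rcases max_choice b b' with h | h <;> rwa [h]
    have hlow : min a a' + min b b' ≤ z :=
      (add_le_add (min_le_left a a') (min_le_left b b')).trans h₁
    have hupp : z ≤ max a a' + max b b' :=
      h₂.trans (add_le_add (le_max_right a a') (le_max_right b b'))
    rcases le_total (z - min b b') (max a a') with h | h
    · exact ⟨z - min b b', hAconv _ hminA _ hmaxA _ (le_sub_iff_add_le.2 hlow) h,
        min b b', hminB, sub_add_cancel _ _⟩
    · exact ⟨max a a', hmaxA, z - max a a',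
        hBconv _ hminB _ hmaxB _ (by linarith) (by linarith), add_sub_cancel _ _⟩

theorem IsNeutrix.esmul {A : Set ℝ*} (hA : IsNeutrix A) (t : ℝ*) : IsNeutrix (esmul t A) := by
  obtain ⟨h0, hadd, hneg, hconv⟩ := hA
  refine ⟨⟨0, h0, mul_zero t⟩, ?_, ?_, ?_⟩
  · rintro _ ⟨a, ha, rfl⟩ _ ⟨b, hb, rfl⟩
    exact ⟨a + b, hadd a ha b hb, mul_add t a b⟩
  · rintro _ ⟨a, ha, rfl⟩
    exact ⟨-a, hneg a ha, mul_neg t a⟩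
  · rintro _ ⟨a, ha, rfl⟩ _ ⟨b, hb, rfl⟩ z h₁ h₂
    dsimp only at h₁ h₂
    rcases lt_trichotomy t 0 with ht | rfl | ht
    · have hz : t * (z / t) = z := mul_div_cancel₀ z ht.ne
      refine ⟨z / t, hconv b hb a ha _ ?_ ?_, hz⟩
      · exact (mul_le_mul_left_of_neg ht).1 (hz.trans_le h₂)
      · exact (mul_le_mul_left_of_neg ht).1 (h₁.trans_eq hz.symm)
    · rw [zero_mul] at h₁ h₂
      exact ⟨0, h0, (mul_zero _).trans (le_antisymm h₁ h₂)⟩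
    · have hz : t * (z / t) = z := mul_div_cancel₀ z ht.ne'
      refine ⟨z / t, hconv a ha b hb _ ?_ ?_, hz⟩
      · exact le_of_mul_le_mul_left (h₁.trans_eq hz.symm) ht
      · exact le_of_mul_le_mul_left (hz.trans_le h₂) ht

theorem coset_add_coset (a b : ℝ*) (A B : Set ℝ*) :
    coset a A + coset b B = coset (a + b) (A + B) := by
  ext z
  constructor
  · rintro ⟨_, ⟨u, hu, rfl⟩, _, ⟨v, hv, rfl⟩, rfl⟩
    exact ⟨u + v, ⟨u, hu, v, hv, rfl⟩, add_add_add_comm a u b v⟩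
  · rintro ⟨_, ⟨u, hu, v, hv, rfl⟩, rfl⟩
    exact ⟨a + u, ⟨u, hu, rfl⟩, b + v, ⟨v, hv, rfl⟩, add_add_add_comm a u b v⟩

theorem esmul_coset (t a : ℝ*) (A : Set ℝ*) :
    esmul t (coset a A) = coset (t * a) (esmul t A) := by
  ext z
  constructor
  · rintro ⟨_, ⟨u, hu, rfl⟩, rfl⟩
    exact ⟨t * u, ⟨u, hu, rfl⟩, mul_add t a u⟩
  · rintro ⟨_, ⟨u, hu, rfl⟩, rfl⟩
    exact ⟨a + u, ⟨u, hu, rfl⟩, mul_add t a u⟩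

theorem coset_zero_left (A : Set ℝ*) : coset 0 A = A := by
  ext z
  simp [coset]

theorem IsExt.exists_eq_coset {α : Set ℝ*} (hα : IsExt α) {x : ℝ*} (hx : x ∈ α) :
    ∃ A, IsNeutrix A ∧ α = coset x A := by
  obtain ⟨a, A, hA, rfl⟩ := hα
  obtain ⟨u, hu, rfl⟩ := hx
  refine ⟨A, hA, ?_⟩
  ext z
  constructor
  · rintro ⟨v, hv, rfl⟩
    exact ⟨v + -u, hA.2.1 v hv _ (hA.2.2.1 u hu), by ring⟩
  · rintro ⟨v, hv, rfl⟩
    exact ⟨u + v, hA.2.1 u hu v hv, add_assoc a u v⟩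

/-- A linear combination of external numbers is a coset of a neutrix, represented by the same
linear combination of representatives. -/
theorem exists_sum_esmul_eq_coset {ι : Type*} (s : Finset ι) (t x : ι → ℝ*) (α : ι → Set ℝ*)
    (hα : ∀ i, IsExt (α i)) (hx : ∀ i, x i ∈ α i) :
    ∃ A, IsNeutrix A ∧ ∑ i ∈ s, esmul (t i) (α i) = coset (∑ i ∈ s, t i * x i) A := by
  induction s using Finset.induction_on with
  | empty => exact ⟨{0}, IsNeutrix.zero_s15, by simp [coset_zero_left, Set.singleton_zero]⟩
  | insert i s hi ih =>
    obtain ⟨A, hA, hsum⟩ := ih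
    obtain ⟨B, hB, hcoset⟩ := (hα i).exists_eq_coset (hx i)
    refine ⟨esmul (t i) B + A, (hB.esmul (t i)).add_s15 hA, ?_⟩
    rw [Finset.sum_insert hi, Finset.sum_insert hi, hsum, hcoset, esmul_coset, coset_add_coset]

theorem linDepE_iff_exists_representatives {ι : Type*} [Fintype ι] {n : ℕ}
    (ξ : ι → Fin n → Set ℝ*) (hξ : ∀ i j, IsExt (ξ i j)) :
    LinDepE ξ ↔
      ∃ x : ι → Fin n → ℝ*, (∀ i j, x i j ∈ ξ i j) ∧ ¬ LinearIndependent ℝ* x := by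
  constructor
  · rintro ⟨t, ht, A, hA, hsum⟩
    have hrep (j : Fin n) : ∃ x : ι → ℝ*, (∀ i, x i ∈ ξ i j) ∧ ∑ i, t i * x i = 0 := by
      have h0 : (0 : ℝ*) ∈ ∑ i, esmul (t i) (ξ i j) := hsum j ▸ (hA j).1
      obtain ⟨g, hg, hg0⟩ := (Set.mem_fintype_sum _ _).1 h0
      choose x hx hxg using hg
      exact ⟨x, hx, by simpa only [hxg] using hg0⟩
    choose x hx hx0 using hrep
    refine ⟨fun i j => x j i, fun i j => hx j i, Fintype.not_linearIndependent_iff.2 ⟨t, ?_, ht⟩⟩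
    ext j
    simpa using hx0 j
  · rintro ⟨x, hx, hdep⟩
    obtain ⟨t, hsum, ht⟩ := Fintype.not_linearIndependent_iff.1 hdep
    have hneutrix (j : Fin n) : ∃ A, IsNeutrix A ∧ ∑ i, esmul (t i) (ξ i j) = A := by
      obtain ⟨A, hA, h⟩ := exists_sum_esmul_eq_coset Finset.univ t (fun i => x i j)
        (fun i => ξ i j) (fun i => hξ i j) (fun i => hx i j)
      have h0 : ∑ i, t i * x i j = 0 := by simpa using congrFun hsum j
      exact ⟨A, hA, by rw [h, h0, coset_zero_left]⟩
    choose A hA hsumA using hneutrix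
    exact ⟨t, ht, A, hA, hsumA⟩

theorem stmt15 {m n : ℕ} (ξ : Fin m → Fin n → Set ℝ*) (hξ : ∀ i j, IsExt (ξ i j)) :
    (LinDepE ξ ↔
      ∃ x : Fin m → Fin n → ℝ*, (∀ i j, x i j ∈ ξ i j) ∧ ¬ LinearIndependent ℝ* x) ∧
    (¬ LinDepE ξ ↔
      ∀ x : Fin m → Fin n → ℝ*, (∀ i j, x i j ∈ ξ i j) → LinearIndependent ℝ* x) := by
  have h := linDepE_iff_exists_representatives ξ hξ
  refine ⟨h, ?_⟩
  rw [h]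
  push Not
  rfl
end
end
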